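/- arXiv:2501.06098 — 2 statements merged into one kernel-verified Lean document; each statement's English description precedes it below -/
import Mathlib

section
/- The Frobenius norms satisfy ‖exp(Q̄)exp(K̄)ᵀ‖_F ≤ (c₁/(𝓜·exp(−0.5))) · ‖exp(Q̄K̄ᵀ)‖_F. -/
open Matrix Finset

/-- Entrywise exponential of a real matrix. -/
noncomputable def eexp {α β : Type*} (A : Matrix α β ℝ) : Matrix α β ℝ := A.map Real.exp

/-- Frobenius norm of a real matrix. -/
noncomputable def frob {α β : Type*} [Fintype α] [Fintype β] (A : Matrix α β ℝ) : ℝ :=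
  Real.sqrt (∑ i, ∑ j, (A i j) ^ 2)

/-- The all-ones square matrix. -/
def allOnes (α : Type*) : Matrix α α ℝ := Matrix.of fun _ _ => 1

/-- 𝔐: the maximum of exp(⟨q̄ᵢ₁, k̄ᵢ₂⟩ + 0.5 − (q̄ᵢ₁ⱼ + k̄ᵢ₂ⱼ)). -/
noncomputable def bigM {ι : Type*} [Fintype ι] [Nonempty ι] {c₁ : ℕ} [NeZero c₁]
    (Q K : Matrix ι (Fin c₁) ℝ) : ℝ :=
  Finset.univ.sup' Finset.univ_nonempty fun p : ι × ι × Fin c₁ =>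
    Real.exp ((∑ j, Q p.1 j * K p.2.1 j) + 0.5 - (Q p.1 p.2.2 + K p.2.1 p.2.2))

/-- 𝓜: the minimum of exp(⟨q̄ᵢ₁, k̄ᵢ₂⟩ + 0.5 − (q̄ᵢ₁ⱼ + k̄ᵢ₂ⱼ)). -/
noncomputable def smallM {ι : Type*} [Fintype ι] [Nonempty ι] {c₁ : ℕ} [NeZero c₁]
    (Q K : Matrix ι (Fin c₁) ℝ) : ℝ :=
  Finset.univ.inf' Finset.univ_nonempty fun p : ι × ι × Fin c₁ =>
    Real.exp ((∑ j, Q p.1 j * K p.2.1 j) + 0.5 - (Q p.1 p.2.2 + K p.2.1 p.2.2))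

/-- Z = I_b ⊗ U_p : the block-diagonal 0/1 mask with b diagonal all-ones p×p blocks. -/
def blockZ (b p : ℕ) : Matrix (Fin b × Fin p) (Fin b × Fin p) ℝ :=
  Matrix.kroneckerMap (· * ·) (1 : Matrix (Fin b) (Fin b) ℝ) (allOnes (Fin p))

theorem frob_le_mul_frob {α β : Type*} [Fintype α] [Fintype β] {A B : Matrix α β ℝ} {c : ℝ}
    (hc : 0 ≤ c) (hA : ∀ i j, 0 ≤ A i j) (hAB : ∀ i j, A i j ≤ c * B i j) :
    frob A ≤ c * frob B := by
  unfold frob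
  rw [Real.sqrt_le_left (mul_nonneg hc (Real.sqrt_nonneg _)), mul_pow,
    Real.sq_sqrt (by positivity), Finset.mul_sum]
  refine Finset.sum_le_sum fun i _ => ?_
  rw [Finset.mul_sum]
  refine Finset.sum_le_sum fun j _ => ?_
  rw [← mul_pow]
  exact pow_le_pow_left₀ (hA i j) (hAB i j) 2

theorem smallM_pos {ι : Type*} [Fintype ι] [Nonempty ι] {c₁ : ℕ} [NeZero c₁]
    (Q K : Matrix ι (Fin c₁) ℝ) : 0 < smallM Q K :=
  (Finset.lt_inf'_iff _).2 fun _ _ => Real.exp_pos _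

theorem smallM_le {ι : Type*} [Fintype ι] [Nonempty ι] {c₁ : ℕ} [NeZero c₁]
    (Q K : Matrix ι (Fin c₁) ℝ) (i₁ i₂ : ι) (j : Fin c₁) :
    smallM Q K ≤ Real.exp ((∑ j, Q i₁ j * K i₂ j) + 0.5 - (Q i₁ j + K i₂ j)) :=
  Finset.inf'_le (fun p : ι × ι × Fin c₁ =>
    Real.exp ((∑ j, Q p.1 j * K p.2.1 j) + 0.5 - (Q p.1 p.2.2 + K p.2.1 p.2.2)))
    (Finset.mem_univ (i₁, i₂, j))

theorem exp_mul_exp_le_div_smallM {ι : Type*} [Fintype ι] [Nonempty ι] {c₁ : ℕ} [NeZero c₁]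
    (Q K : Matrix ι (Fin c₁) ℝ) (i₁ i₂ : ι) (j : Fin c₁) :
    Real.exp (Q i₁ j) * Real.exp (K i₂ j) ≤
      Real.exp (∑ j, Q i₁ j * K i₂ j) / (smallM Q K * Real.exp (-0.5)) := by
  rw [le_div_iff₀ (mul_pos (smallM_pos Q K) (Real.exp_pos _))]
  calc Real.exp (Q i₁ j) * Real.exp (K i₂ j) * (smallM Q K * Real.exp (-0.5))
      ≤ Real.exp (Q i₁ j) * Real.exp (K i₂ j) *
          (Real.exp ((∑ j, Q i₁ j * K i₂ j) + 0.5 - (Q i₁ j + K i₂ j)) * Real.exp (-0.5)) := by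
        gcongr
        exact smallM_le Q K i₁ i₂ j
    _ = Real.exp (∑ j, Q i₁ j * K i₂ j) := by
        simp only [← Real.exp_add]
        congr 1
        ring

/-- ‖exp(Q̄)exp(K̄)ᵀ‖_F ≤ (c₁/(𝓜·exp(−0.5))) · ‖exp(Q̄K̄ᵀ)‖_F. -/
theorem stmt_4 (m c₁ : ℕ) [NeZero m] [NeZero c₁] (Qb Kb : Matrix (Fin m) (Fin c₁) ℝ) :
    frob (eexp Qb * (eexp Kb)ᵀ) ≤
      (c₁ : ℝ) / (smallM Qb Kb * Real.exp (-0.5)) * frob (eexp (Qb * Kbᵀ)) := by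
  have hpos := mul_pos (smallM_pos Qb Kb) (Real.exp_pos (-0.5))
  refine frob_le_mul_frob (by positivity) (fun i₁ i₂ => ?_) fun i₁ i₂ => ?_
  · simp only [eexp, Matrix.mul_apply, Matrix.transpose_apply, Matrix.map_apply]
    positivity
  · simp only [eexp, Matrix.mul_apply, Matrix.transpose_apply, Matrix.map_apply]
    refine (Finset.sum_le_card_nsmul _ _ _
      fun j _ => exp_mul_exp_le_div_smallM Qb Kb i₁ i₂ j).trans_eq ?_
    rw [Finset.card_univ, Fintype.card_fin, nsmul_eq_mul]
    ring
end

section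
/- The Frobenius norms satisfy ‖exp(Q̄)exp(K̄)ᵀ‖_F ≥ (c₁/(𝔐·exp(−0.5))) · ‖exp(Q̄K̄ᵀ)‖_F. -/
open Matrix Finset

theorem frob_mono_of_nonneg {α β : Type*} [Fintype α] [Fintype β] {A B : Matrix α β ℝ}
    (hA : ∀ i j, 0 ≤ A i j) (hAB : ∀ i j, A i j ≤ B i j) : frob A ≤ frob B :=
  Real.sqrt_le_sqrt <| Finset.sum_le_sum fun i _ => Finset.sum_le_sum fun j _ =>
    pow_le_pow_left₀ (hA i j) (hAB i j) 2

theorem frob_smul_of_nonneg {α β : Type*} [Fintype α] [Fintype β] {c : ℝ} (hc : 0 ≤ c)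
    (A : Matrix α β ℝ) : frob (c • A) = c * frob A := by
  simp only [frob, Matrix.smul_apply, smul_eq_mul, mul_pow, ← Finset.mul_sum]
  rw [Real.sqrt_mul (sq_nonneg c), Real.sqrt_sq hc]

theorem exp_le_bigM {ι : Type*} [Fintype ι] [Nonempty ι] {c₁ : ℕ} [NeZero c₁]
    (Q K : Matrix ι (Fin c₁) ℝ) (a b : ι) (j : Fin c₁) :
    Real.exp ((∑ l, Q a l * K b l) + 0.5 - (Q a j + K b j)) ≤ bigM Q K :=
  Finset.le_sup' (fun p : ι × ι × Fin c₁ =>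
    Real.exp ((∑ l, Q p.1 l * K p.2.1 l) + 0.5 - (Q p.1 p.2.2 + K p.2.1 p.2.2)))
    (Finset.mem_univ (a, b, j))

theorem bigM_pos {ι : Type*} [Fintype ι] [Nonempty ι] {c₁ : ℕ} [NeZero c₁]
    (Q K : Matrix ι (Fin c₁) ℝ) : 0 < bigM Q K :=
  (Real.exp_pos _).trans_le (exp_le_bigM Q K (Classical.arbitrary ι) (Classical.arbitrary ι) 0)

theorem card_mul_eexp_mul_transpose_le {ι : Type*} [Fintype ι] [Nonempty ι] {c₁ : ℕ} [NeZero c₁]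
    (Q K : Matrix ι (Fin c₁) ℝ) (a b : ι) :
    (c₁ : ℝ) * eexp (Q * Kᵀ) a b ≤
      bigM Q K * Real.exp (-0.5) * (eexp Q * (eexp K)ᵀ) a b := by
  have h : ∀ j, Real.exp (∑ l, Q a l * K b l) ≤
      bigM Q K * Real.exp (-0.5) * (Real.exp (Q a j) * Real.exp (K b j)) := fun j =>
    calc Real.exp (∑ l, Q a l * K b l)
        = Real.exp ((∑ l, Q a l * K b l) + 0.5 - (Q a j + K b j)) * Real.exp (-0.5) *
            (Real.exp (Q a j) * Real.exp (K b j)) := by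
          simp only [← Real.exp_add]
          ring_nf
      _ ≤ _ := by
          gcongr
          exact exp_le_bigM Q K a b j
  simpa [eexp, Matrix.mul_apply, Finset.mul_sum] using
    Finset.sum_le_sum fun j (_ : j ∈ Finset.univ) => h j

/-- ‖exp(Q̄)exp(K̄)ᵀ‖_F ≥ (c₁/(𝔐·exp(−0.5))) · ‖exp(Q̄K̄ᵀ)‖_F. -/
theorem stmt_5 (m c₁ : ℕ) [NeZero m] [NeZero c₁] (Qb Kb : Matrix (Fin m) (Fin c₁) ℝ) :
    frob (eexp Qb * (eexp Kb)ᵀ) ≥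
      (c₁ : ℝ) / (bigM Qb Kb * Real.exp (-0.5)) * frob (eexp (Qb * Kbᵀ)) := by
  have hM : 0 < bigM Qb Kb * Real.exp (-0.5) := mul_pos (bigM_pos Qb Kb) (Real.exp_pos _)
  rw [ge_iff_le, ← frob_smul_of_nonneg (by positivity)]
  refine frob_mono_of_nonneg (fun a b => ?_) (fun a b => ?_)
  · exact mul_nonneg (by positivity) (Real.exp_pos _).le
  · rw [Matrix.smul_apply, smul_eq_mul, div_mul_eq_mul_div, div_le_iff₀' hM]
    exact card_mul_eexp_mul_transpose_le Qb Kb a b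
end
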